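/- For every prime power q there exists a real constant C_{q,2} > 0 such that: (i) there is an absolute constant C with |B₂(2n,q) − C_{q,2} · binom(n−1/2, n) · q^{2n}| ≤ C · q^{2n−1} / n^{3/2} for all positive integers n, and (ii) there is an absolute constant C′ with |C_{q,2} − 1| ≤ C′/q. -/

import Mathlib

/-- Generalized binomial coefficient `binom(x, n) = x(x-1)⋯(x-n+1)/n!` for real `x`. -/
noncomputable def rbinom (x : ℝ) (n : ℕ) : ℝ :=
  (∏ i ∈ Finset.range n, (x - (i : ℝ))) / (Nat.factorial n : ℝ)

section FactorDegrees

open Polynomial UniqueFactorizationMonoid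

theorem finite_setOf_monic_natDegree_eq (F : Type*) [Field F] [Finite F] (n : ℕ) :
    {f : F[X] | f.Monic ∧ f.natDegree = n}.Finite := by
  have : Finite (degreeLT F n) := Finite.of_equiv _ (degreeLTEquiv F n).toEquiv.symm
  exact Finite.of_equiv _ (monicEquivDegreeLT (R := F) n).symm

theorem natCard_monic_natDegree_eq (F : Type*) [Field F] [Fintype F] (n : ℕ) :
    Nat.card {f : F[X] // f.Monic ∧ f.natDegree = n} = Fintype.card F ^ n := by
  rw [Nat.card_congr ((monicEquivDegreeLT (R := F) n).trans (degreeLTEquiv F n).toEquiv)]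
  simp

/-- The monic polynomials of degree `n` all of whose monic irreducible factors have a degree
satisfying `p`. -/
noncomputable def monicWithFactorDegrees (F : Type*) [Field F] [Finite F] (p : ℕ → Prop) (n : ℕ) :
    Finset F[X] :=
  Set.Finite.toFinset (s := {f : F[X] | f.Monic ∧ f.natDegree = n ∧
      ∀ P : F[X], P.Monic → Irreducible P → P ∣ f → p P.natDegree})
    ((finite_setOf_monic_natDegree_eq F n).subset fun _ hf ↦ ⟨hf.1, hf.2.1⟩)

/-- The monic irreducible polynomials of degree `d`. -/
noncomputable def monicIrreducibles (F : Type*) [Field F] [Finite F] (d : ℕ) : Finset F[X] :=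
  Set.Finite.toFinset (s := {f : F[X] | f.Monic ∧ f.natDegree = d ∧ Irreducible f})
    ((finite_setOf_monic_natDegree_eq F d).subset fun _ hf ↦ ⟨hf.1, hf.2.1⟩)

section
variable {F : Type*} [Field F] [Finite F] {p : ℕ → Prop} {n d : ℕ} {f : F[X]}

theorem mem_monicWithFactorDegrees :
    f ∈ monicWithFactorDegrees F p n ↔ f.Monic ∧ f.natDegree = n ∧
      ∀ P : F[X], P.Monic → Irreducible P → P ∣ f → p P.natDegree := by
  simp [monicWithFactorDegrees]

theorem mem_monicIrreducibles :
    f ∈ monicIrreducibles F d ↔ f.Monic ∧ f.natDegree = d ∧ Irreducible f := by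
  simp [monicIrreducibles]
end

theorem card_monicWithFactorDegrees_zero (F : Type*) [Field F] [Finite F] (p : ℕ → Prop) :
    (monicWithFactorDegrees F p 0).card = 1 := by
  rw [Finset.card_eq_one]
  refine ⟨1, Finset.eq_singleton_iff_unique_mem.2 ⟨?_, fun f hf ↦ ?_⟩⟩
  · exact mem_monicWithFactorDegrees.2 ⟨monic_one, natDegree_one,
      fun P _ hP h ↦ absurd (isUnit_of_dvd_one h) hP.not_isUnit⟩
  · obtain ⟨hm, hn, -⟩ := mem_monicWithFactorDegrees.1 hf
    exact eq_one_of_monic_natDegree_zero hm hn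

theorem card_monicWithFactorDegrees_true (F : Type*) [Field F] [Fintype F] (n : ℕ) :
    (monicWithFactorDegrees F (fun _ ↦ True) n).card = Fintype.card F ^ n := by
  rw [← natCard_monic_natDegree_eq F n, ← Nat.card_eq_finsetCard]
  exact Nat.card_congr (Equiv.subtypeEquivRight fun f ↦ by simp [mem_monicWithFactorDegrees])

open Classical in
theorem sum_ite_pow_dvd {F : Type*} [Field F] {f P : F[X]} {n : ℕ}
    (hf : f.Monic) (hn : f.natDegree = n) (hP : P.Monic) (hPi : Irreducible P) :
    ∑ k ∈ Finset.Icc 1 n, (if P ^ k ∣ f then P.natDegree else 0) =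
      (normalizedFactors f).count P * P.natDegree := by
  have key : ∀ k, P ^ k ∣ f ↔ k ≤ (normalizedFactors f).count P := by
    intro k
    rw [pow_dvd_iff_le_emultiplicity, emultiplicity_eq_count_normalizedFactors hPi hf.ne_zero,
      hP.normalize_eq_self]
    exact Nat.cast_le
  have hle : (normalizedFactors f).count P ≤ n := by
    have h := natDegree_le_of_dvd ((key _).2 le_rfl) hf.ne_zero
    rw [hP.natDegree_pow, hn] at h
    exact (Nat.le_mul_of_pos_right _ hPi.natDegree_pos).trans h
  rw [← Finset.sum_filter, Finset.sum_const, smul_eq_mul]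
  congr 1
  have : (Finset.Icc 1 n).filter (fun k ↦ P ^ k ∣ f) =
      Finset.Icc 1 ((normalizedFactors f).count P) := by
    ext k
    simp only [Finset.mem_filter, Finset.mem_Icc, key]
    omega
  rw [this]
  simp

theorem natDegree_eq_sum_count {F : Type*} [Field F] [DecidableEq F] {f : F[X]} (hf : f.Monic) :
    f.natDegree =
      ∑ P ∈ (normalizedFactors f).toFinset, (normalizedFactors f).count P * P.natDegree := by
  have hprod : (normalizedFactors f).prod = f := by
    rw [prod_normalizedFactors_eq hf.ne_zero, hf.normalize_eq_self]
  conv_lhs => rw [← hprod]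
  rw [natDegree_multiset_prod_of_monic, Finset.sum_multiset_map_count]
  · simp
  · intro P hP
    exact ((Polynomial.mem_normalizedFactors_iff hf.ne_zero).1 hP).2.1

open Classical in
theorem sum_sum_sum_ite_pow_dvd {F : Type*} [Field F] [Finite F] {p : ℕ → Prop} {n : ℕ} {f : F[X]}
    (hf : f ∈ monicWithFactorDegrees F p n) :
    ∑ d ∈ Finset.Icc 1 n with p d, ∑ P ∈ monicIrreducibles F d, ∑ k ∈ Finset.Icc 1 n,
      (if P ^ k ∣ f then d else 0) = n := by
  obtain ⟨hm, hn, hp⟩ := mem_monicWithFactorDegrees.1 hf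
  have hmem := fun P ↦ Polynomial.mem_normalizedFactors_iff (p := P) hm.ne_zero
  trans ∑ P ∈ (Finset.Icc 1 n).filter p |>.biUnion (monicIrreducibles F),
      (normalizedFactors f).count P * P.natDegree
  · rw [Finset.sum_biUnion]
    · refine Finset.sum_congr rfl fun d _ ↦ Finset.sum_congr rfl fun P hP ↦ ?_
      obtain ⟨hPm, rfl, hPi⟩ := mem_monicIrreducibles.1 hP
      exact sum_ite_pow_dvd hm hn hPm hPi
    · intro d _ e _ hde
      refine Finset.disjoint_left.2 fun P hP hP' ↦ hde ?_
      rw [← (mem_monicIrreducibles.1 hP).2.1, (mem_monicIrreducibles.1 hP').2.1]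
  · conv_rhs => rw [← hn, natDegree_eq_sum_count hm]
    symm
    apply Finset.sum_subset
    · intro P hP
      obtain ⟨hPi, hPm, hPf⟩ := (hmem P).1 (Multiset.mem_toFinset.1 hP)
      simp only [Finset.mem_biUnion, Finset.mem_filter, Finset.mem_Icc]
      exact ⟨P.natDegree, ⟨⟨hPi.natDegree_pos, hn ▸ natDegree_le_of_dvd hPf hm.ne_zero⟩,
        hp P hPm hPi hPf⟩, mem_monicIrreducibles.2 ⟨hPm, rfl, hPi⟩⟩
    · intro P _ hP
      rw [Multiset.count_eq_zero_of_notMem (fun h ↦ hP (Multiset.mem_toFinset.2 h)), zero_mul]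

open Classical in
theorem card_filter_pow_dvd {F : Type*} [Field F] [Finite F] {p : ℕ → Prop} {n d k : ℕ} {P : F[X]}
    (hP : P ∈ monicIrreducibles F d) (hd : p d) :
    ((monicWithFactorDegrees F p n).filter (P ^ k ∣ ·)).card =
      if k * d ≤ n then (monicWithFactorDegrees F p (n - k * d)).card else 0 := by
  obtain ⟨hPm, rfl, hPi⟩ := mem_monicIrreducibles.1 hP
  split_ifs with h
  · symm
    refine Finset.card_bij (fun g _ ↦ P ^ k * g) ?_ ?_ ?_
    · intro g hg
      obtain ⟨hgm, hgn, hgp⟩ := mem_monicWithFactorDegrees.1 hg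
      refine Finset.mem_filter.2 ⟨mem_monicWithFactorDegrees.2
        ⟨(hPm.pow k).mul hgm, ?_, fun Q hQm hQi hQ ↦ ?_⟩, dvd_mul_right _ _⟩
      · rw [(hPm.pow k).natDegree_mul hgm, hPm.natDegree_pow, hgn]
        omega
      · rcases hQi.prime.dvd_or_dvd hQ with hQ | hQ
        · have hQP := hQi.prime.dvd_of_dvd_pow hQ
          rwa [eq_of_monic_of_associated hQm hPm (hQi.associated_of_dvd hPi hQP)]
        · exact hgp Q hQm hQi hQ
    · intro g _ g' _ h
      exact mul_left_cancel₀ (hPm.pow k).ne_zero h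
    · intro f hf
      obtain ⟨hf, g, rfl⟩ := Finset.mem_filter.1 hf
      obtain ⟨hfm, hfn, hfp⟩ := mem_monicWithFactorDegrees.1 hf
      have hgm := (hPm.pow k).of_mul_monic_left hfm
      refine ⟨g, mem_monicWithFactorDegrees.2 ⟨hgm, ?_, fun Q hQm hQi hQ ↦
        hfp Q hQm hQi (hQ.mul_left _)⟩, rfl⟩
      rw [(hPm.pow k).natDegree_mul hgm, hPm.natDegree_pow] at hfn
      omega
  · rw [Finset.card_eq_zero, Finset.filter_eq_empty_iff]
    intro f hf hdvd
    obtain ⟨hfm, hfn, -⟩ := mem_monicWithFactorDegrees.1 hf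
    have := natDegree_le_of_dvd hdvd hfm.ne_zero
    rw [hPm.natDegree_pow, hfn] at this
    exact h this

open Classical in
/-- The number of monic prime powers of degree `m` over primes whose degree satisfies `p`,
weighted by the degree of the underlying prime. -/
noncomputable def weightedPrimePowerCount (F : Type*) [Field F] [Finite F] (p : ℕ → Prop) (m : ℕ) :
    ℕ :=
  ∑ d ∈ m.divisors with p d, d * (monicIrreducibles F d).card

theorem sum_Icc_ite_mul_le {d n : ℕ} (hd : 0 < d) (g : ℕ → ℕ) :
    ∑ k ∈ Finset.Icc 1 n, (if k * d ≤ n then g (k * d) else 0) =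
      ∑ m ∈ Finset.Icc 1 n, if d ∣ m then g m else 0 := by
  rw [← Finset.sum_filter, ← Finset.sum_filter]
  refine Finset.sum_bij (fun k _ ↦ k * d) ?_ ?_ ?_ fun _ _ ↦ rfl
  · intro k hk
    simp only [Finset.mem_filter, Finset.mem_Icc] at hk ⊢
    exact ⟨⟨Nat.mul_pos hk.1.1 hd, hk.2⟩, dvd_mul_left _ _⟩
  · intro a _ b _ h
    exact Nat.eq_of_mul_eq_mul_right hd h
  · intro m hm
    simp only [Finset.mem_filter, Finset.mem_Icc] at hm
    obtain ⟨⟨h1, h2⟩, k, rfl⟩ := hm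
    refine ⟨k, ?_, mul_comm _ _⟩
    simp only [Finset.mem_filter, Finset.mem_Icc]
    exact ⟨⟨Nat.pos_of_mul_pos_left h1, (Nat.le_mul_of_pos_left k hd).trans h2⟩, by rwa [mul_comm]⟩

theorem natDegree_mul_card_monicWithFactorDegrees (F : Type*) [Field F] [Finite F] (p : ℕ → Prop)
    (n : ℕ) :
    n * (monicWithFactorDegrees F p n).card =
      ∑ m ∈ Finset.Icc 1 n,
        weightedPrimePowerCount F p m * (monicWithFactorDegrees F p (n - m)).card := by
  classical
  let N := fun n ↦ (monicWithFactorDegrees F p n).card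
  calc n * N n = ∑ f ∈ monicWithFactorDegrees F p n, n := by simp [N, mul_comm]
    _ = ∑ f ∈ monicWithFactorDegrees F p n, ∑ d ∈ Finset.Icc 1 n with p d,
          ∑ P ∈ monicIrreducibles F d, ∑ k ∈ Finset.Icc 1 n, (if P ^ k ∣ f then d else 0) :=
        Finset.sum_congr rfl fun f hf ↦ (sum_sum_sum_ite_pow_dvd hf).symm
    _ = ∑ d ∈ Finset.Icc 1 n with p d, ∑ P ∈ monicIrreducibles F d, ∑ k ∈ Finset.Icc 1 n,
          d * (if k * d ≤ n then N (n - k * d) else 0) := by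
        rw [Finset.sum_comm]
        refine Finset.sum_congr rfl fun d hd ↦ ?_
        rw [Finset.sum_comm]
        refine Finset.sum_congr rfl fun P hP ↦ ?_
        rw [Finset.sum_comm]
        refine Finset.sum_congr rfl fun k _ ↦ ?_
        rw [← Finset.sum_filter, Finset.sum_const, smul_eq_mul,
          card_filter_pow_dvd hP (Finset.mem_filter.1 hd).2, mul_comm]
    _ = ∑ d ∈ Finset.Icc 1 n with p d, ∑ m ∈ Finset.Icc 1 n,
          if d ∣ m then d * (monicIrreducibles F d).card * N (n - m) else 0 := by
        refine Finset.sum_congr rfl fun d hd ↦ ?_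
        rw [Finset.sum_const, ← Finset.mul_sum, sum_Icc_ite_mul_le (g := fun m ↦ N (n - m))
          (Finset.mem_Icc.1 (Finset.mem_filter.1 hd).1).1, smul_eq_mul, ← mul_assoc,
          mul_comm _ d, Finset.mul_sum]
        simp only [mul_ite, mul_zero]
    _ = _ := by
        rw [Finset.sum_comm]
        refine Finset.sum_congr rfl fun m hm ↦ ?_
        rw [weightedPrimePowerCount, Finset.sum_mul, ← Finset.sum_filter]
        refine Finset.sum_congr ?_ fun _ _ ↦ rfl
        ext d
        simp only [Finset.mem_filter, Finset.mem_Icc, Nat.mem_divisors] at hm ⊢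
        constructor
        · rintro ⟨⟨_, hp⟩, hdm⟩
          exact ⟨⟨hdm, by omega⟩, hp⟩
        · rintro ⟨⟨hdm, _⟩, hp⟩
          have := Nat.le_of_dvd (by omega) hdm
          exact ⟨⟨⟨Nat.pos_of_dvd_of_pos hdm (by omega), by omega⟩, hp⟩, hdm⟩

theorem weightedPrimePowerCount_true (F : Type*) [Field F] [Fintype F] {m : ℕ} (hm : 0 < m) :
    weightedPrimePowerCount F (fun _ ↦ True) m = Fintype.card F ^ m := by
  obtain ⟨n, rfl⟩ : ∃ n, m = n + 1 := ⟨m - 1, by omega⟩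
  have h1 := natDegree_mul_card_monicWithFactorDegrees F (fun _ ↦ True) n
  have h2 := natDegree_mul_card_monicWithFactorDegrees F (fun _ ↦ True) (n + 1)
  simp only [card_monicWithFactorDegrees_true] at h1 h2
  rw [Finset.sum_Icc_succ_top (by omega)] at h2
  have h3 : ∑ m ∈ Finset.Icc 1 n, weightedPrimePowerCount F (fun _ ↦ True) m *
      Fintype.card F ^ (n + 1 - m) = Fintype.card F * (n * Fintype.card F ^ n) := by
    rw [h1, Finset.mul_sum]
    refine Finset.sum_congr rfl fun m hm ↦ ?_
    rw [Nat.sub_add_comm (Finset.mem_Icc.1 hm).2]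
    ring
  rw [h3] at h2
  simp only [Nat.sub_self, pow_zero, mul_one] at h2
  have : (n + 1) * Fintype.card F ^ (n + 1) =
    Fintype.card F * (n * Fintype.card F ^ n) + Fintype.card F ^ (n + 1) := by ring
  omega

theorem weightedPrimePowerCount_add_not (F : Type*) [Field F] [Fintype F] (p : ℕ → Prop) {m : ℕ}
    (hm : 0 < m) :
    weightedPrimePowerCount F p m + weightedPrimePowerCount F (¬ p ·) m =
      Fintype.card F ^ m := by
  rw [← weightedPrimePowerCount_true F hm]
  simp only [weightedPrimePowerCount, Finset.filter_true]
  classical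
  convert Finset.sum_filter_add_sum_filter_not m.divisors p _

theorem weightedPrimePowerCount_eq_zero {F : Type*} [Field F] [Finite F] {p : ℕ → Prop} {m : ℕ}
    (h : ∀ d, d ∣ m → ¬ p d) : weightedPrimePowerCount F p m = 0 := by
  classical
  refine Finset.sum_eq_zero fun d hd ↦ ?_
  obtain ⟨hdm, hd⟩ := Finset.mem_filter.1 hd
  exact absurd hd (h d (Nat.dvd_of_mem_divisors hdm))

theorem weightedPrimePowerCount_odd_two_mul (F : Type*) [Field F] [Finite F] (k : ℕ) :
    weightedPrimePowerCount F (¬ Even ·) (2 * k) = weightedPrimePowerCount F (¬ Even ·) k := by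
  classical
  refine Finset.sum_congr ?_ fun _ _ ↦ rfl
  ext d
  simp only [Finset.mem_filter, Nat.mem_divisors, Nat.not_even_iff_odd]
  constructor
  · rintro ⟨⟨h, h0⟩, hd⟩
    exact ⟨⟨hd.coprime_two_right.dvd_of_dvd_mul_left h, by omega⟩, hd⟩
  · rintro ⟨⟨h, h0⟩, hd⟩
    exact ⟨⟨h.mul_left 2, by omega⟩, hd⟩

theorem weightedPrimePowerCount_even_two_mul (F : Type*) [Field F] [Fintype F] {k : ℕ}
    (hk : 0 < k) :
    weightedPrimePowerCount F Even (2 * k) + Fintype.card F ^ k =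
      Fintype.card F ^ (2 * k) + weightedPrimePowerCount F Even k := by
  rw [← weightedPrimePowerCount_add_not F Even hk,
    ← weightedPrimePowerCount_add_not F Even (m := 2 * k) (by omega),
    weightedPrimePowerCount_odd_two_mul]
  ring

theorem mul_card_monicWithFactorDegrees_even (F : Type*) [Field F] [Finite F] (n : ℕ) :
    2 * n * (monicWithFactorDegrees F Even (2 * n)).card =
      ∑ k ∈ Finset.Icc 1 n, weightedPrimePowerCount F Even (2 * k) *
        (monicWithFactorDegrees F Even (2 * (n - k))).card := by
  rw [natDegree_mul_card_monicWithFactorDegrees]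
  symm
  refine Finset.sum_of_injOn (2 * ·) (fun a _ b _ h ↦ by simpa using h) ?_ ?_ ?_
  · intro k hk
    simp only [Finset.coe_Icc, Set.mem_Icc] at hk ⊢
    omega
  · intro m hm hm'
    rw [weightedPrimePowerCount_eq_zero, zero_mul]
    intro d hdm hd
    obtain ⟨r, rfl⟩ := hd.trans_dvd hdm
    simp only [Finset.mem_Icc] at hm
    exact hm' ⟨r, by simp only [Finset.coe_Icc, Set.mem_Icc]; omega, by simp only; omega⟩
  · intro k _
    simp only [Nat.mul_sub]

end FactorDegrees

theorem rbinom_sub_half_zero : rbinom (((0 : ℕ) : ℝ) - 1 / 2) 0 = 1 := by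
  simp [rbinom]

theorem rbinom_sub_half_succ (k : ℕ) :
    rbinom (((k + 1 : ℕ) : ℝ) - 1 / 2) (k + 1) * (k + 1) =
      rbinom ((k : ℝ) - 1 / 2) k * (k + 1 / 2) := by
  have h : ∏ i ∈ Finset.range k, (((k + 1 : ℕ) : ℝ) - 1 / 2 - ((i + 1 : ℕ) : ℝ)) =
      ∏ i ∈ Finset.range k, ((k : ℝ) - 1 / 2 - i) :=
    Finset.prod_congr rfl fun i _ ↦ by push_cast; ring
  rw [rbinom, rbinom, Finset.prod_range_succ', h, Nat.factorial_succ]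
  have := Nat.factorial_ne_zero k
  push_cast
  field_simp
  ring

theorem rbinom_sub_half_pos (k : ℕ) : 0 < rbinom ((k : ℝ) - 1 / 2) k := by
  induction k with
  | zero => simp [rbinom]
  | succ k ih =>
    have h := rbinom_sub_half_succ k
    refine pos_of_mul_pos_left (b := (k + 1 : ℝ)) ?_ (by positivity)
    rw [h]
    positivity

theorem rbinom_sub_half_sub_succ (k : ℕ) :
    rbinom ((k : ℝ) - 1 / 2) k - rbinom (((k + 1 : ℕ) : ℝ) - 1 / 2) (k + 1) =
      rbinom ((k : ℝ) - 1 / 2) k / (2 * (k + 1)) := by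
  have h := rbinom_sub_half_succ k
  generalize rbinom ((k : ℝ) - 1 / 2) k = x at *
  generalize rbinom (((k + 1 : ℕ) : ℝ) - 1 / 2) (k + 1) = y at *
  field_simp
  linear_combination -2 * h

theorem rbinom_sub_half_sq_mul_le (k : ℕ) : rbinom ((k : ℝ) - 1 / 2) k ^ 2 * (k + 1) ≤ 1 := by
  induction k with
  | zero => simp [rbinom]
  | succ k ih =>
    have h := rbinom_sub_half_succ k
    set x := rbinom ((k : ℝ) - 1 / 2) k
    set y := rbinom (((k + 1 : ℕ) : ℝ) - 1 / 2) (k + 1)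
    have hy : y = x * (k + 1 / 2) / (k + 1) := by field_simp; linear_combination 2 * h
    have hk : (0 : ℝ) ≤ k := k.cast_nonneg
    have e : y ^ 2 * (((k + 1 : ℕ) : ℝ) + 1) =
        (x ^ 2 * (k + 1)) * ((k + 1 / 2) ^ 2 * (k + 2) / (k + 1) ^ 3) := by
      rw [hy]; push_cast; field_simp; ring
    rw [e]
    refine mul_le_one₀ ih (by positivity) ?_
    rw [div_le_one (by positivity)]
    nlinarith

theorem rbinom_sub_half_le_one (k : ℕ) : rbinom ((k : ℝ) - 1 / 2) k ≤ 1 := by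
  have h1 := rbinom_sub_half_sq_mul_le k
  have h2 := rbinom_sub_half_pos k
  have hk : (0 : ℝ) ≤ k := k.cast_nonneg
  by_contra! h
  nlinarith [mul_self_nonneg (rbinom ((k : ℝ) - 1 / 2) k)]

theorem sum_range_rbinom_sub_half (n : ℕ) :
    ∑ k ∈ Finset.range n, rbinom ((k : ℝ) - 1 / 2) k = 2 * n * rbinom ((n : ℝ) - 1 / 2) n := by
  induction n with
  | zero => simp
  | succ n ih =>
    rw [Finset.sum_range_succ, ih]
    have := rbinom_sub_half_succ n
    push_cast at this ⊢
    linear_combination -2 * this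

/-- The decrement at index `n - 1`, compared with its order of magnitude at index `N ≤ n * j`. -/
theorem rbinom_sub_half_sub_succ_le {k j N : ℕ} (hN : 0 < N) (h : N ≤ (k + 1) * j) :
    rbinom ((k : ℝ) - 1 / 2) k - rbinom (((k + 1 : ℕ) : ℝ) - 1 / 2) (k + 1) ≤
      (j : ℝ) ^ 2 / (N : ℝ) ^ ((3 : ℝ) / 2) := by
  rw [rbinom_sub_half_sub_succ]
  have hj : (1 : ℝ) ≤ j := by
    exact_mod_cast Nat.one_le_iff_ne_zero.2 fun h0 ↦ by subst h0; omega
  have hN' : (0 : ℝ) < N := by exact_mod_cast hN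
  have h' : (N : ℝ) ≤ (k + 1) * j := by exact_mod_cast h
  have hx := rbinom_sub_half_pos k
  have hsq := rbinom_sub_half_sq_mul_le k
  set x := rbinom ((k : ℝ) - 1 / 2) k
  have hp : (0 : ℝ) < (N : ℝ) ^ ((3 : ℝ) / 2) := by positivity
  have hp2 : ((N : ℝ) ^ ((3 : ℝ) / 2)) ^ 2 = (N : ℝ) ^ 3 := by
    rw [← Real.rpow_natCast, ← Real.rpow_mul hN'.le]
    norm_num
  rw [div_le_div_iff₀ (by positivity) hp]
  refine (pow_le_pow_iff_left₀ (by positivity) (by positivity) two_ne_zero).1 ?_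
  rw [mul_pow, hp2]
  calc x ^ 2 * (N : ℝ) ^ 3 ≤ x ^ 2 * ((k + 1) * j) ^ 3 := by gcongr
    _ = x ^ 2 * (k + 1) * (((k + 1) ^ 2 : ℝ) * j ^ 3) := by ring
    _ ≤ 1 * (((k + 1) ^ 2 : ℝ) * j ^ 3) := by gcongr
    _ ≤ (((k + 1) ^ 2 : ℝ) * j ^ 4) := by
      rw [one_mul]
      gcongr ?_ * ?_
      exact pow_le_pow_right₀ hj (by norm_num)
    _ ≤ (j ^ 2 * (2 * (k + 1))) ^ 2 := by
      have : (0 : ℝ) ≤ (k + 1) ^ 2 * j ^ 4 := by positivity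
      nlinarith

theorem rbinom_sub_half_antitone : Antitone fun k : ℕ ↦ rbinom ((k : ℝ) - 1 / 2) k := by
  refine antitone_nat_of_succ_le fun k ↦ sub_nonneg.1 ?_
  rw [rbinom_sub_half_sub_succ]
  have := rbinom_sub_half_pos k
  positivity

theorem abs_ite_rbinom_sub_half_sub_le {n : ℕ} (hn : 0 < n) (j : ℕ) :
    |(if j ≤ n then rbinom (((n - j : ℕ) : ℝ) - 1 / 2) (n - j) else 0) -
        rbinom ((n : ℝ) - 1 / 2) n| ≤ (j : ℝ) ^ 3 / (n : ℝ) ^ ((3 : ℝ) / 2) := by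
  have hn' : (0 : ℝ) < n := by exact_mod_cast hn
  split_ifs with hj
  · rw [abs_of_nonneg (sub_nonneg.2 (rbinom_sub_half_antitone (Nat.sub_le n j)))]
    have key : ∀ i ≤ j, rbinom (((n - i : ℕ) : ℝ) - 1 / 2) (n - i) -
        rbinom ((n : ℝ) - 1 / 2) n ≤ i * ((j : ℝ) ^ 2 / (n : ℝ) ^ ((3 : ℝ) / 2)) := by
      intro i
      induction i with
      | zero => simp
      | succ i ih =>
        intro hi
        have h1 := ih (by omega)
        have h2 := rbinom_sub_half_sub_succ_le (k := n - (i + 1)) (j := j) hn (by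
          obtain ⟨m, rfl⟩ : ∃ m, n = m + (i + 1) := ⟨n - (i + 1), by omega⟩
          obtain ⟨l, rfl⟩ : ∃ l, j = l + (i + 1) := ⟨j - (i + 1), by omega⟩
          simp only [Nat.add_sub_cancel]
          nlinarith [Nat.zero_le (m * l), Nat.zero_le (m * i)])
        rw [show n - (i + 1) + 1 = n - i by omega] at h2
        push_cast
        linarith
    refine (key j le_rfl).trans_eq ?_
    ring
  · rw [zero_sub, abs_neg, abs_of_pos (rbinom_sub_half_pos n)]
    refine (rbinom_sub_half_le_one n).trans ?_
    rw [one_le_div (by positivity)]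
    have hjn : (n : ℝ) ≤ j := by exact_mod_cast (not_le.1 hj).le
    have h1 : (1 : ℝ) ≤ n := by exact_mod_cast hn
    calc (n : ℝ) ^ ((3 : ℝ) / 2) ≤ (n : ℝ) ^ (3 : ℝ) :=
          Real.rpow_le_rpow_of_exponent_le h1 (by norm_num)
      _ = (n : ℝ) ^ 3 := by exact_mod_cast Real.rpow_natCast (n : ℝ) 3
      _ ≤ (j : ℝ) ^ 3 := by gcongr

open PowerSeries in
theorem X_mul_derivative_mk_eq_iff {L a : ℕ → ℝ} (hL : L 0 = 0) :
    X * d⁄dX ℝ (mk a) = mk L * mk a ↔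
      ∀ n : ℕ, n * a n = ∑ k ∈ Finset.Icc 1 n, L k * a (n - k) := by
  rw [PowerSeries.ext_iff]
  refine forall_congr' fun n ↦ ?_
  have h1 : coeff n (X * d⁄dX ℝ (mk a)) = n * a n := by
    cases n with
    | zero => simp
    | succ n => simp [coeff_succ_X_mul, coeff_derivative, mul_comm]
  have h2 : coeff n (mk L * mk a) = ∑ k ∈ Finset.Icc 1 n, L k * a (n - k) := by
    rw [coeff_mul]
    simp only [coeff_mk]
    rw [Finset.Nat.sum_antidiagonal_eq_sum_range_succ (fun i j ↦ L i * a j),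
      Finset.range_eq_Ico, Finset.sum_eq_sum_Ico_succ_bot (by omega), hL, zero_mul, zero_add]
    rfl
  rw [h1, h2]

open PowerSeries in
/-- Dividing solutions of `n a_n = ∑ L_k a_{n-k}` subtracts the corresponding sequences `L`. -/
theorem exists_convolution_quotient {L M a c : ℕ → ℝ} (hL : L 0 = 0) (hM : M 0 = 0)
    (ha0 : a 0 = 1) (hc0 : c 0 = 1)
    (ha : ∀ n : ℕ, n * a n = ∑ k ∈ Finset.Icc 1 n, L k * a (n - k))
    (hc : ∀ n : ℕ, n * c n = ∑ k ∈ Finset.Icc 1 n, M k * c (n - k)) :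
    ∃ h : ℕ → ℝ, h 0 = 1 ∧ (∀ n, a n = ∑ j ∈ Finset.range (n + 1), h j * c (n - j)) ∧
      ∀ n : ℕ, n * h n = ∑ k ∈ Finset.Icc 1 n, (L k - M k) * h (n - k) := by
  have hA := (X_mul_derivative_mk_eq_iff hL).2 ha
  have hC := (X_mul_derivative_mk_eq_iff hM).2 hc
  have hcc : constantCoeff (mk c) ≠ 0 := by
    rw [← coeff_zero_eq_constantCoeff_apply, coeff_mk, hc0]
    exact one_ne_zero
  have hCne : mk c ≠ 0 := fun h ↦ hcc (by rw [h, map_zero])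
  let H : PowerSeries ℝ := mk a * (mk c)⁻¹
  have hHC : H * mk c = mk a := by
    rw [mul_assoc, PowerSeries.inv_mul_cancel _ hcc, mul_one]
  have hH : mk (fun n ↦ coeff n H) = H := by ext; simp
  have hconv : ∀ n, a n = ∑ j ∈ Finset.range (n + 1), coeff j H * c (n - j) := by
    intro n
    have := congrArg (coeff n) hHC
    rw [coeff_mul, coeff_mk] at this
    simp only [coeff_mk] at this
    rw [← this, Finset.Nat.sum_antidiagonal_eq_sum_range_succ (fun i j ↦ coeff i H * c j)]
  refine ⟨fun n ↦ coeff n H, ?_, hconv, ?_⟩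
  · have := hconv 0
    simpa [ha0, hc0] using this.symm
  · refine (X_mul_derivative_mk_eq_iff (L := fun k ↦ L k - M k) (by simp [hL, hM])).1 ?_
    rw [hH, show mk (fun k ↦ L k - M k) = mk L - mk M by ext; simp]
    refine mul_right_cancel₀ hCne ?_
    have hd : d⁄dX ℝ (mk a) = H * d⁄dX ℝ (mk c) + mk c * d⁄dX ℝ H := by
      rw [← hHC, Derivation.leibniz, smul_eq_mul, smul_eq_mul]
    rw [hd, ← hHC] at hA
    linear_combination hA - H * hC

theorem abs_le_half_mul_pow_of_recursion {ε h : ℕ → ℝ} {r : ℝ} (h0 : h 0 = 1)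
    (hr : 0 ≤ r) (hε : ∀ k, 0 < k → |ε k| ≤ r ^ k / 2)
    (hh : ∀ n : ℕ, n * h n = ∑ k ∈ Finset.Icc 1 n, ε k * h (n - k)) {n : ℕ} (hn : 0 < n) :
    |h n| ≤ r ^ n / 2 := by
  suffices ∀ m, |h m| ≤ r ^ m ∧ (0 < m → |h m| ≤ r ^ m / 2) from (this n).2 hn
  intro m
  induction m using Nat.strong_induction_on with
  | _ m ih =>
    rcases m.eq_zero_or_pos with rfl | hm
    · simp [h0]
    have hm' : (0 : ℝ) < m := by exact_mod_cast hm
    have key : m * |h m| ≤ m * (r ^ m / 2) := by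
      rw [← abs_of_pos hm', ← abs_mul, abs_of_pos hm', hh]
      calc |∑ k ∈ Finset.Icc 1 m, ε k * h (m - k)|
          ≤ ∑ k ∈ Finset.Icc 1 m, |ε k * h (m - k)| := Finset.abs_sum_le_sum_abs _ _
        _ ≤ ∑ k ∈ Finset.Icc 1 m, r ^ m / 2 := by
            refine Finset.sum_le_sum fun k hk ↦ ?_
            rw [Finset.mem_Icc] at hk
            rw [abs_mul]
            calc |ε k| * |h (m - k)| ≤ r ^ k / 2 * r ^ (m - k) :=
                  mul_le_mul (hε k hk.1) (ih _ (by omega)).1 (abs_nonneg _) (by positivity)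
              _ = r ^ (k + (m - k)) / 2 := by rw [pow_add]; ring
              _ = r ^ m / 2 := by rw [Nat.add_sub_cancel' hk.2]
        _ = m * (r ^ m / 2) := by simp
    have := le_of_mul_le_mul_left key hm'
    have hr' : 0 ≤ r ^ m := by positivity
    exact ⟨by linarith, fun _ ↦ this⟩

theorem sum_Icc_half_mul_rbinom (n : ℕ) :
    n * rbinom ((n : ℝ) - 1 / 2) n = ∑ k ∈ Finset.Icc 1 n,
      (if k = 0 then 0 else 1 / 2 : ℝ) * rbinom (((n - k : ℕ) : ℝ) - 1 / 2) (n - k) := by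
  have h : ∑ k ∈ Finset.Icc 1 n,
      (if k = 0 then 0 else 1 / 2 : ℝ) * rbinom (((n - k : ℕ) : ℝ) - 1 / 2) (n - k) =
      ∑ k ∈ Finset.range n, 1 / 2 * rbinom ((k : ℝ) - 1 / 2) k := by
    refine Finset.sum_bij' (fun k _ ↦ n - k) (fun k _ ↦ n - k) ?_ ?_ ?_ ?_ ?_
    all_goals
      intro k hk
      simp only [Finset.mem_Icc, Finset.mem_range] at hk ⊢
      try omega
    rw [if_neg (by omega)]
  rw [h, ← Finset.mul_sum, sum_range_rbinom_sub_half]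
  ring

theorem summable_pow_three_mul_half_pow : Summable fun j : ℕ ↦ (j : ℝ) ^ 3 * (2 * (1 / 2) ^ j) := by
  have := (summable_pow_mul_geometric_of_norm_lt_one (R := ℝ) 3 (r := 1 / 2)
    (by norm_num)).mul_left 2
  refine this.congr fun j ↦ ?_
  ring

/-- If the logarithmic derivative of a power series is exponentially close to that of
`(1 - x) ^ (-1 / 2)`, its coefficients are asymptotic to those of a multiple of this function. -/
theorem exists_asymptotic_of_recursion {q : ℝ} (hq : 2 ≤ q) {L a : ℕ → ℝ} (hL0 : L 0 = 0)
    (ha0 : a 0 = 1) (hL : ∀ k, 0 < k → |L k - 1 / 2| ≤ q⁻¹ ^ k / 2)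
    (ha : ∀ n : ℕ, n * a n = ∑ k ∈ Finset.Icc 1 n, L k * a (n - k)) :
    ∃ C : ℝ, 0 < C ∧
      (∀ n : ℕ, 0 < n → |a n - C * rbinom ((n : ℝ) - 1 / 2) n| ≤
        (∑' j : ℕ, (j : ℝ) ^ 3 * (2 * (1 / 2) ^ j)) / q / (n : ℝ) ^ ((3 : ℝ) / 2)) ∧
      |C - 1| ≤ (∑' j : ℕ, (j : ℝ) ^ 3 * (2 * (1 / 2) ^ j)) / q := by
  have hq0 : 0 < q := by linarith
  obtain ⟨h, h0, hconv, hrec⟩ := exists_convolution_quotient hL0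
    (M := fun k ↦ if k = 0 then 0 else 1 / 2) (c := fun k ↦ rbinom ((k : ℝ) - 1 / 2) k)
    (by simp) ha0 rbinom_sub_half_zero ha sum_Icc_half_mul_rbinom
  have hbound : ∀ n, 0 < n → |h n| ≤ q⁻¹ ^ n / 2 := fun n hn ↦
    abs_le_half_mul_pow_of_recursion h0 (by positivity)
      (fun k hk ↦ by simpa [hk.ne'] using hL k hk) hrec hn
  have hqinv : q⁻¹ ≤ 1 / 2 := by
    rw [one_div]
    exact inv_anti₀ two_pos hq
  have hhalf : ∀ j, |h (j + 1)| ≤ 1 / 2 * (1 / 2) ^ (j + 1) := fun j ↦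
    (hbound (j + 1) j.succ_pos).trans (by
      have : q⁻¹ ^ (j + 1) ≤ (1 / 2) ^ (j + 1) := by gcongr
      linarith)
  have hw : ∀ j : ℕ, (j : ℝ) ^ 3 * |h j| ≤ (j : ℝ) ^ 3 * (2 * (1 / 2) ^ j) / q := by
    intro j
    rcases j with _ | j
    · simp
    rw [mul_div_assoc]
    refine mul_le_mul_of_nonneg_left ((hbound _ j.succ_pos).trans ?_) (by positivity)
    have h1 : q⁻¹ ^ j ≤ (1 / 2) ^ j := by gcongr
    have h2 : 0 < q⁻¹ := by positivity
    rw [pow_succ, pow_succ, div_eq_mul_inv _ q]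
    have h3 : 0 ≤ q⁻¹ ^ j := by positivity
    nlinarith
  have hwsum := summable_pow_three_mul_half_pow.div_const q
  have hsum3 : Summable fun j : ℕ ↦ (j : ℝ) ^ 3 * |h j| :=
    hwsum.of_nonneg_of_le (fun j ↦ by positivity) hw
  have hK : ∑' j : ℕ, (j : ℝ) ^ 3 * |h j| ≤ (∑' j : ℕ, (j : ℝ) ^ 3 * (2 * (1 / 2) ^ j)) / q := by
    rw [← tsum_div_const]
    exact hsum3.tsum_le_tsum hw hwsum
  have hgeom : HasSum (fun j : ℕ ↦ (1 / 2 : ℝ) * (1 / 2) ^ (j + 1)) (1 / 2) := by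
    have := hasSum_geometric_two.mul_left (1 / 4 : ℝ)
    convert! this using 1
    · ext j; ring
    · norm_num
  have habs1 : Summable fun j ↦ |h (j + 1)| :=
    hgeom.summable.of_nonneg_of_le (fun _ ↦ abs_nonneg _) hhalf
  have hsum : Summable h := ((summable_nat_add_iff 1).1 habs1.of_abs)
  have hC : ∑' j, h j - 1 = ∑' j, h (j + 1) := by
    rw [hsum.tsum_eq_zero_add, h0, add_sub_cancel_left]
  have hCabs : |∑' j, h j - 1| ≤ ∑' j, |h (j + 1)| := by
    rw [hC]
    simpa using norm_tsum_le_tsum_norm (f := fun j ↦ h (j + 1)) (by simpa using habs1)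
  refine ⟨∑' j, h j, ?_, fun n hn ↦ ?_, ?_⟩
  · have h1 : ∑' j, |h (j + 1)| ≤ 1 / 2 := hgeom.tsum_eq ▸ habs1.tsum_le_tsum hhalf hgeom.summable
    have := (abs_le.1 (hCabs.trans h1)).1
    linarith
  · let D : ℕ → ℝ := fun j ↦
      (if j ≤ n then rbinom (((n - j : ℕ) : ℝ) - 1 / 2) (n - j) else 0) - rbinom ((n : ℝ) - 1 / 2) n
    have hfin : HasSum (fun j ↦ h j *
        (if j ≤ n then rbinom (((n - j : ℕ) : ℝ) - 1 / 2) (n - j) else 0)) (a n) := by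
      rw [hconv n]
      rw [Finset.sum_congr rfl fun j hj ↦ show h j * rbinom (((n - j : ℕ) : ℝ) - 1 / 2) (n - j) =
        h j * (if j ≤ n then rbinom (((n - j : ℕ) : ℝ) - 1 / 2) (n - j) else 0) by
          rw [if_pos (by rw [Finset.mem_range] at hj; omega)]]
      refine hasSum_sum_of_ne_finset_zero fun j hj ↦ ?_
      rw [Finset.mem_range] at hj
      rw [if_neg (by omega), mul_zero]
    have hD : HasSum (fun j ↦ h j * D j)
        (a n - (∑' j, h j) * rbinom ((n : ℝ) - 1 / 2) n) := by
      convert! hfin.sub (hsum.hasSum.mul_right (rbinom ((n : ℝ) - 1 / 2) n)) using 2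
      simp only [D]
      ring
    have hle : ∀ j, |h j * D j| ≤ (j : ℝ) ^ 3 * |h j| / (n : ℝ) ^ ((3 : ℝ) / 2) := fun j ↦ by
      rw [abs_mul, mul_comm, mul_div_right_comm]
      exact mul_le_mul_of_nonneg_right (abs_ite_rbinom_sub_half_sub_le hn j) (abs_nonneg _)
    have hsn := hsum3.div_const ((n : ℝ) ^ ((3 : ℝ) / 2))
    have hDabs : Summable fun j ↦ |h j * D j| :=
      hsn.of_nonneg_of_le (fun _ ↦ abs_nonneg _) hle
    rw [← hD.tsum_eq]
    calc |∑' j, h j * D j| ≤ ∑' j, |h j * D j| := by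
          simpa only [Real.norm_eq_abs] using
            norm_tsum_le_tsum_norm (f := fun j ↦ h j * D j) (by simpa only [Real.norm_eq_abs])
      _ ≤ ∑' j : ℕ, (j : ℝ) ^ 3 * |h j| / (n : ℝ) ^ ((3 : ℝ) / 2) := hDabs.tsum_le_tsum hle hsn
      _ = (∑' j : ℕ, (j : ℝ) ^ 3 * |h j|) / (n : ℝ) ^ ((3 : ℝ) / 2) := tsum_div_const
      _ ≤ _ := by gcongr
  · refine hCabs.trans (le_trans ?_ hK)
    rw [hsum3.tsum_eq_zero_add]
    simp only [Nat.cast_zero, ne_eq, OfNat.ofNat_ne_zero, not_false_eq_true, zero_pow, zero_mul,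
      zero_add]
    refine habs1.tsum_le_tsum (fun j ↦ ?_) ((summable_nat_add_iff 1).2 hsum3)
    refine le_mul_of_one_le_left (abs_nonneg _) (one_le_pow₀ ?_)
    exact_mod_cast Nat.succ_le_succ j.zero_le

/-- For every prime power `q` (i.e. every finite field `F` with `q = card F`) there is a constant
`C_{q,2} > 0` such that `B₂(2n, q)`, the number of monic polynomials of degree `2n` all of whose
monic irreducible factors have even degree, satisfies
`|B₂(2n,q) − C_{q,2} · binom(n − 1/2, n) · q^{2n}| ≤ C · q^{2n−1}/n^{3/2}` for all `n ≥ 1`,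
and `|C_{q,2} − 1| ≤ C′/q`, where `C` and `C′` are absolute constants. -/
theorem landau_even_degree_factors :
    ∃ C C' : ℝ, 0 < C ∧ 0 < C' ∧
      ∀ (F : Type) [Field F] [Fintype F],
        ∃ Cq2 : ℝ, 0 < Cq2 ∧
          (∀ n : ℕ, 0 < n →
            |(Nat.card {f : Polynomial F // f.Monic ∧ f.natDegree = 2 * n ∧
                  ∀ P : Polynomial F, P.Monic → Irreducible P → P ∣ f → Even P.natDegree} : ℝ) -
                Cq2 * rbinom ((n : ℝ) - 1 / 2) n * (Fintype.card F : ℝ) ^ (2 * n)| ≤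
              C * (Fintype.card F : ℝ) ^ (2 * n - 1) / (n : ℝ) ^ ((3 : ℝ) / 2)) ∧
          |Cq2 - 1| ≤ C' / (Fintype.card F : ℝ) := by
  refine ⟨∑' j : ℕ, (j : ℝ) ^ 3 * (2 * (1 / 2) ^ j), ∑' j : ℕ, (j : ℝ) ^ 3 * (2 * (1 / 2) ^ j),
    ?_, ?_, fun F _ _ ↦ ?_⟩
  · exact summable_pow_three_mul_half_pow.tsum_pos (fun j ↦ by positivity) 1 (by norm_num)
  · exact summable_pow_three_mul_half_pow.tsum_pos (fun j ↦ by positivity) 1 (by norm_num)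
  have hq : (2 : ℝ) ≤ Fintype.card F := by exact_mod_cast Fintype.one_lt_card (α := F)
  have hcard : ∀ n : ℕ, Nat.card {f : Polynomial F // f.Monic ∧ f.natDegree = 2 * n ∧
      ∀ P : Polynomial F, P.Monic → Irreducible P → P ∣ f → Even P.natDegree} =
      (monicWithFactorDegrees F Even (2 * n)).card := fun n ↦ by
    rw [← Nat.card_eq_finsetCard]
    exact Nat.card_congr (Equiv.subtypeEquivRight fun f ↦ mem_monicWithFactorDegrees.symm)
  have hL : ∀ k : ℕ, 0 < k → |(weightedPrimePowerCount F Even (2 * k) : ℝ) /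
      (2 * (Fintype.card F : ℝ) ^ (2 * k)) - 1 / 2| ≤ (Fintype.card F : ℝ)⁻¹ ^ k / 2 := by
    intro k hk
    have h1 : (weightedPrimePowerCount F Even (2 * k) : ℝ) + (Fintype.card F : ℝ) ^ k =
        (Fintype.card F : ℝ) ^ (2 * k) + weightedPrimePowerCount F Even k := by
      exact_mod_cast weightedPrimePowerCount_even_two_mul F hk
    have h2 : (weightedPrimePowerCount F Even k : ℝ) ≤ (Fintype.card F : ℝ) ^ k := by
      exact_mod_cast (Nat.le_add_right _ _).trans_eq (weightedPrimePowerCount_add_not F Even hk)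
    have h3 : (0 : ℝ) ≤ weightedPrimePowerCount F Even k := Nat.cast_nonneg _
    have hqk : (0 : ℝ) < (Fintype.card F : ℝ) ^ k := by positivity
    rw [pow_mul', inv_pow] at *
    generalize (Fintype.card F : ℝ) ^ k = x at *
    have e : (weightedPrimePowerCount F Even (2 * k) : ℝ) / (2 * x ^ 2) - 1 / 2 =
        (weightedPrimePowerCount F Even k - x) / (2 * x ^ 2) := by
      field_simp
      linear_combination h1
    rw [e, abs_div, abs_of_nonpos (by linarith), abs_of_pos (by positivity),
      div_le_iff₀ (by positivity)]
    field_simp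
    linarith
  obtain ⟨C, hC, h1, h2⟩ := exists_asymptotic_of_recursion hq
    (L := fun k ↦ if k = 0 then 0 else
      (weightedPrimePowerCount F Even (2 * k) : ℝ) / (2 * (Fintype.card F : ℝ) ^ (2 * k)))
    (a := fun n ↦ ((monicWithFactorDegrees F Even (2 * n)).card : ℝ) /
      (Fintype.card F : ℝ) ^ (2 * n))
    (by simp) (by simp [card_monicWithFactorDegrees_zero])
    (fun k hk ↦ by simpa only [if_neg hk.ne'] using hL k hk) (fun n ↦ by
      have h : (2 * n * (monicWithFactorDegrees F Even (2 * n)).card : ℝ) =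
          ∑ k ∈ Finset.Icc 1 n, (weightedPrimePowerCount F Even (2 * k) : ℝ) *
            (monicWithFactorDegrees F Even (2 * (n - k))).card := by
        exact_mod_cast mul_card_monicWithFactorDegrees_even F n
      rw [← mul_div_assoc, show (n * (monicWithFactorDegrees F Even (2 * n)).card : ℝ) =
        (2 * n * (monicWithFactorDegrees F Even (2 * n)).card : ℝ) / 2 by ring, h,
        div_div, Finset.sum_div]
      refine Finset.sum_congr rfl fun k hk ↦ ?_
      obtain ⟨hk1, hkn⟩ := Finset.mem_Icc.1 hk
      rw [if_neg (by omega), div_mul_div_comm, mul_assoc, ← pow_add]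
      congr 3
      omega)
  refine ⟨C, hC, fun n hn ↦ ?_, h2⟩
  have hpos : (0 : ℝ) < (Fintype.card F : ℝ) ^ (2 * n) := by positivity
  rw [hcard]
  calc |((monicWithFactorDegrees F Even (2 * n)).card : ℝ) -
        C * rbinom ((n : ℝ) - 1 / 2) n * (Fintype.card F : ℝ) ^ (2 * n)|
      = |((monicWithFactorDegrees F Even (2 * n)).card : ℝ) / (Fintype.card F : ℝ) ^ (2 * n) -
          C * rbinom ((n : ℝ) - 1 / 2) n| * (Fintype.card F : ℝ) ^ (2 * n) := by
        rw [← abs_of_pos hpos, ← abs_mul, abs_of_pos hpos, sub_mul, div_mul_cancel₀ _ hpos.ne']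
    _ ≤ _ := mul_le_mul_of_nonneg_right (h1 n hn) hpos.le
    _ = _ := by
        generalize ∑' j : ℕ, (j : ℝ) ^ 3 * (2 * (1 / 2) ^ j) = K
        rw [show 2 * n = 2 * n - 1 + 1 by omega, pow_succ, Nat.add_sub_cancel]
        field_simp
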